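/- arXiv:hep-th/9911030 — 3 statements merged into one kernel-verified Lean document; each statement's English description precedes it below -/
import Mathlib

section
/- Assume sinh(ξ_i − ξ_j + η) ≠ 0 for all 1 ≤ i,j ≤ N. Let S^z = (1/2)·diag(1,−1) and let S^z_n be its action on the n-th tensor factor of H (identity elsewhere). Then for every 1 ≤ n ≤ N: (∏_{i=1}^{n−1} (A+D)(ξ_i)) · (1/2)(A−D)(ξ_n) = S^z_n · (∏_{i=1}^{n} (A+D)(ξ_i)); equivalently, if the (A+D)(ξ_i) are invertible, S^z_n = (∏_{i=1}^{n−1} (A+D)(ξ_i)) · (1/2)(A−D)(ξ_n) · (∏_{i=1}^{n} (A+D)(ξ_i))^{−1}. -/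
open Matrix Complex

noncomputable section

/-- The 4×4 R-matrix on ℂ² ⊗ ℂ² with parameters `b`, `c`, in the ordered basis
(e₁⊗e₁, e₁⊗e₂, e₂⊗e₁, e₂⊗e₂) given by [[1,0,0,0],[0,b,c,0],[0,c,b,0],[0,0,0,1]]. -/
def Rmat (b c : ℂ) : Matrix (Fin 2 × Fin 2) (Fin 2 × Fin 2) ℂ :=
  Matrix.of fun p q =>
    if p = q then (if p.1 = p.2 then 1 else b)
    else if p.1 = q.2 ∧ p.2 = q.1 then c else 0

/-- The trigonometric (XXZ) R-matrix, with b(λ,μ) = sinh(λ−μ)/sinh(λ−μ+η),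
c(λ,μ) = sinh(η)/sinh(λ−μ+η). -/
def Rxxz (η lam mu : ℂ) : Matrix (Fin 2 × Fin 2) (Fin 2 × Fin 2) ℂ :=
  Rmat (Complex.sinh (lam - mu) / Complex.sinh (lam - mu + η))
       (Complex.sinh η / Complex.sinh (lam - mu + η))

variable {N : ℕ}

/-- Embedding of an operator on ℂ²(aux) ⊗ ℂ²(site n) into (aux) ⊗ H, H = ⊗ⁿ ℂ². -/
def embS (n : Fin N) (M : Matrix (Fin 2 × Fin 2) (Fin 2 × Fin 2) ℂ) :
    Matrix (Fin 2 × (Fin N → Fin 2)) (Fin 2 × (Fin N → Fin 2)) ℂ :=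
  Matrix.of fun p q =>
    M (p.1, p.2 n) (q.1, q.2 n) *
      ∏ j : Fin N, if j = n then 1 else (if p.2 j = q.2 j then 1 else 0)

/-- The inhomogeneous XXZ monodromy matrix `T₀(λ) = R₀N(λ,ξ_N) ⋯ R₀1(λ,ξ_1)`. -/
def Tmon (η : ℂ) (ξ : Fin N → ℂ) (lam : ℂ) :
    Matrix (Fin 2 × (Fin N → Fin 2)) (Fin 2 × (Fin N → Fin 2)) ℂ :=
  ((List.ofFn fun n : Fin N => embS n (Rxxz η lam (ξ n))).reverse).prod

/-- The operator entry `T_{ε,ε'}(λ)` of the monodromy matrix, so that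
`T₁₁ = A`, `T₁₂ = B`, `T₂₁ = C`, `T₂₂ = D`. -/
def blkT (η : ℂ) (ξ : Fin N → ℂ) (ε ε' : Fin 2) (lam : ℂ) :
    Matrix (Fin N → Fin 2) (Fin N → Fin 2) ℂ :=
  Matrix.of fun x y => Tmon η ξ lam (ε, x) (ε', y)

/-- The transfer matrix `t(λ) = A(λ) + D(λ)`. -/
def tT (η : ℂ) (ξ : Fin N → ℂ) (lam : ℂ) : Matrix (Fin N → Fin 2) (Fin N → Fin 2) ℂ :=
  blkT η ξ 0 0 lam + blkT η ξ 1 1 lam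

/-- The operator acting as `M` on the `n`-th tensor factor of H and as the identity elsewhere. -/
def embH (n : Fin N) (M : Matrix (Fin 2) (Fin 2) ℂ) :
    Matrix (Fin N → Fin 2) (Fin N → Fin 2) ℂ :=
  Matrix.of fun x y =>
    M (x n) (y n) * ∏ j : Fin N, if j = n then 1 else (if x j = y j then 1 else 0)

/-- The ordered product `∏_{i=1}^{n} (A+D)(ξ_i)` of transfer matrices. -/
def prodT (η : ℂ) (ξ : Fin N → ℂ) (n : ℕ) (h : n ≤ N) :
    Matrix (Fin N → Fin 2) (Fin N → Fin 2) ℂ :=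
  (List.ofFn fun i : Fin n => tT η ξ (ξ (Fin.castLE h i))).prod

section Lists

variable {ι M : Type*} [Monoid M]

/-- The inverses `r' i`, multiplied in the opposite order, cancel the right factors `r i`. -/
theorem prod_map_mul_mul_reverse_prod (a r r' : ι → M) (p : List ι)
    (hr : ∀ i ∈ p, r i * r' i = 1) (hc : p.Pairwise fun i j => Commute (a j) (r' i)) :
    (p.map fun i => a i * r i).prod * (p.map r').reverse.prod = (p.map a).prod := by
  induction p with
  | nil => simp
  | cons i p ih =>
    rw [List.pairwise_cons] at hc
    have hcomm : Commute (p.map a).prod (r' i) :=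
      Commute.list_prod_left _ _ (by simpa using hc.1)
    have ih' := ih (fun j hj => hr j (List.mem_cons_of_mem _ hj)) hc.2
    simp only [List.map_cons, List.prod_cons, List.reverse_cons, List.prod_append, List.prod_nil,
      mul_one]
    calc a i * r i * (p.map fun i => a i * r i).prod * ((p.map r').reverse.prod * r' i)
        = a i * r i * ((p.map fun i => a i * r i).prod * (p.map r').reverse.prod * r' i) := by
          simp only [mul_assoc]
      _ = a i * (r i * r' i) * (p.map a).prod := by rw [ih', hcomm.eq]; simp only [mul_assoc]
      _ = a i * (p.map a).prod := by rw [hr i List.mem_cons_self, mul_one]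

variable (r : ι → ι → M) (t : ι → M)

theorem prod_map_reverse_prod_cons_mul {p q : List ι} {k : ι} (hl : (p ++ k :: q).Nodup)
    (hr : ∀ i j, i ≠ j → r i j * r j i = 1)
    (hc : ∀ i j k m, i ≠ k → i ≠ m → j ≠ k → j ≠ m → Commute (r i j) (r k m)) :
    (p.map fun i => ((k :: q).map (r i)).reverse.prod).prod * (p.map (r k)).reverse.prod =
      (p.map fun i => (q.map (r i)).reverse.prod).prod := by
  rw [List.nodup_append] at hl
  obtain ⟨hp, hkq, hdisj⟩ := hl
  rw [List.nodup_cons] at hkq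
  rw [← prod_map_mul_mul_reverse_prod (fun i => (q.map (r i)).reverse.prod)
    (fun i => r i k) (r k) p (fun i hi => hr i k (hdisj i hi k List.mem_cons_self))]
  · simp
  refine List.Nodup.pairwise_of_forall_ne hp fun i hi j hj hij =>
    Commute.list_prod_left _ _ ?_
  simp only [List.mem_reverse, List.mem_map, forall_exists_index, and_imp,
    forall_apply_eq_imp_iff₂]
  intro m hm
  exact hc _ _ _ _ (hdisj j hj k List.mem_cons_self) hij.symm
    (by rintro rfl; exact hkq.1 hm) (hdisj i hi m (List.mem_cons_of_mem _ hm)).symm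

/-- If `r i j` and `r k m` commute for disjoint indices and `r i j * r j i = 1`, the ordered
products of `t k = (r k (k-1) ⋯ r k 1) (r k N ⋯ r k (k+1))` telescope. -/
theorem prod_map_eq_prod_map_reverse_prod {l : List ι} (hl : l.Nodup)
    (hr : ∀ i j, i ≠ j → r i j * r j i = 1)
    (hc : ∀ i j k m, i ≠ k → i ≠ m → j ≠ k → j ≠ m → Commute (r i j) (r k m))
    (ht : ∀ p k q, l = p ++ k :: q →
      t k = (p.map (r k)).reverse.prod * (q.map (r k)).reverse.prod)
    {p q : List ι} (hpq : l = p ++ q) :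
    (p.map t).prod = (p.map fun i => (q.map (r i)).reverse.prod).prod := by
  induction p using List.reverseRecOn generalizing q with
  | nil => simp
  | append_singleton p k ih =>
    have hpq' : l = p ++ k :: q := by simpa using hpq
    rw [hpq'] at hl
    simp only [List.map_append, List.prod_append, List.map_cons, List.map_nil, List.prod_cons,
      List.prod_nil, mul_one]
    rw [ht p k q hpq', ih hpq', ← mul_assoc, prod_map_reverse_prod_cons_mul r hl hr hc]

/-- An element commuting with the `r i j` away from `k` can be moved through the ordered product. -/
theorem prod_map_mul_eq_mul_prod_map {l : List ι} (hl : l.Nodup)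
    (hr : ∀ i j, i ≠ j → r i j * r j i = 1)
    (hc : ∀ i j k m, i ≠ k → i ≠ m → j ≠ k → j ≠ m → Commute (r i j) (r k m))
    (ht : ∀ p k q, l = p ++ k :: q →
      t k = (p.map (r k)).reverse.prod * (q.map (r k)).reverse.prod)
    {p q : List ι} {k : ι} (hpq : l = p ++ k :: q) {x : M}
    (hx : ∀ i j, i ≠ k → j ≠ k → Commute x (r i j)) :
    (p.map t).prod * ((p.map (r k)).reverse.prod * x * (q.map (r k)).reverse.prod) =
      x * ((p ++ [k]).map t).prod := by
  have hcollapse : (p.map t).prod * (p.map (r k)).reverse.prod =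
      (p.map fun i => (q.map (r i)).reverse.prod).prod := by
    rw [prod_map_eq_prod_map_reverse_prod r t hl hr hc ht hpq,
      prod_map_reverse_prod_cons_mul r (hpq ▸ hl) hr hc]
  have hcomm : Commute x (p.map fun i => (q.map (r i)).reverse.prod).prod := by
    rw [hpq, List.nodup_append, List.nodup_cons] at hl
    refine Commute.list_prod_right _ _ ?_
    simp only [List.mem_map, forall_exists_index, and_imp, forall_apply_eq_imp_iff₂]
    refine fun i hi => Commute.list_prod_right _ _ ?_
    simp only [List.mem_reverse, List.mem_map, forall_exists_index, and_imp,
      forall_apply_eq_imp_iff₂]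
    exact fun m hm => hx i m (hl.2.2 i hi k List.mem_cons_self)
      (by rintro rfl; exact hl.2.1.1 hm)
  simp only [List.map_append, List.prod_append, List.map_cons, List.map_nil, List.prod_cons,
    List.prod_nil, mul_one]
  rw [ht p k q hpq, ← mul_assoc (p.map t).prod, ← mul_assoc (p.map t).prod,
    ← mul_assoc (p.map t).prod, hcollapse, ← mul_assoc x, hcomm.eq]

end Lists

section LocalOperators

variable {K A F ι : Type*} [CommRing K] [Ring A] [Algebra K A] [Fintype F] [DecidableEq F]

/-- Substitutes the elementary matrices of the site `s` for those of the auxiliary space in the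
matrix of operators `W`. -/
def contract (s : Matrix F F K →ₐ[K] A) (W : Matrix F F A) : A :=
  ∑ a, ∑ b, W a b * s (single a b 1)

theorem map_eq_sum_smul (s : Matrix F F K →ₐ[K] A) (x : Matrix F F K) :
    s x = ∑ a, ∑ b, x a b • s (single a b 1) := by
  conv_lhs => rw [matrix_eq_sum_single x]
  simp only [map_sum]
  refine Finset.sum_congr rfl fun a _ => Finset.sum_congr rfl fun b _ => ?_
  rw [← map_smul, smul_single, smul_eq_mul, mul_one]

theorem contract_map_algebraMap (s : Matrix F F K →ₐ[K] A) (x : Matrix F F K) :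
    contract s (x.map (algebraMap K A)) = s x := by
  simp only [map_eq_sum_smul s x, contract, Matrix.map_apply, Algebra.smul_def]

theorem contract_one (s : Matrix F F K →ₐ[K] A) : contract s 1 = 1 := by
  have h := contract_map_algebraMap s (1 : Matrix F F K)
  rwa [Matrix.map_one _ (map_zero _) (map_one _), map_one] at h

theorem contract_mul (s : Matrix F F K →ₐ[K] A) (V W : Matrix F F A)
    (hW : ∀ a b x, Commute (W a b) (s x)) :
    contract s (V * W) = contract s V * contract s W := by
  have hsingle : ∀ a b, s (single a b 1) * contract s W = ∑ d, W b d * s (single a d 1) := by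
    intro a b
    rw [contract, Finset.mul_sum, Finset.sum_eq_single b]
    · rw [Finset.mul_sum]
      refine Finset.sum_congr rfl fun d _ => ?_
      rw [← mul_assoc, ← (hW _ _ _).eq, mul_assoc, ← map_mul, single_mul_single_same, mul_one]
    · intro c _ hc
      rw [Finset.mul_sum]
      refine Finset.sum_eq_zero fun d _ => ?_
      rw [← mul_assoc, ← (hW _ _ _).eq, mul_assoc, ← map_mul,
        single_mul_single_of_ne _ _ _ _ hc.symm, map_zero, mul_zero]
    · simp
  rw [contract, contract, Finset.sum_mul]
  refine Finset.sum_congr rfl fun a _ => ?_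
  simp only [Finset.sum_mul, mul_assoc, hsingle, Finset.mul_sum, Matrix.mul_apply]
  exact Finset.sum_comm

/-- Multiplying by the permutation operator between the auxiliary space and the site `s` and
tracing out the auxiliary space. -/
theorem trace_mul_permutation_mul (s : Matrix F F K →ₐ[K] A) (W V : Matrix F F A)
    (hV : ∀ a b x, Commute (V a b) (s x)) (hVW : ∀ a b c d, Commute (V a b) (W c d)) :
    trace (W * Matrix.of (fun a c => s (single c a 1)) * V) = contract s (V * W) := by
  simp only [trace, diag_apply, Matrix.mul_apply, contract, Matrix.of_apply, Finset.sum_mul]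
  have h : ∀ a b c, W a b * s (single c b 1) * V c a = V c a * W a b * s (single c b 1) := by
    intro a b c
    rw [mul_assoc, ← (hV _ _ _).eq, ← mul_assoc, (hVW _ _ _ _).eq]
  simp only [h]
  calc ∑ a, ∑ c, ∑ b, V c a * W a b * s (single c b 1)
      = ∑ c, ∑ a, ∑ b, V c a * W a b * s (single c b 1) := Finset.sum_comm
    _ = ∑ c, ∑ b, ∑ a, V c a * W a b * s (single c b 1) :=
      Finset.sum_congr rfl fun _ _ => Finset.sum_comm

/-- An operator on (aux) ⊗ (site), as a matrix over the auxiliary space with entries acting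
on the site `s`. -/
def laxHom (s : Matrix F F K →ₐ[K] A) : Matrix (F × F) (F × F) K →ₐ[K] Matrix F F A :=
  s.mapMatrix.comp (compAlgEquiv F F K K).symm.toAlgHom

theorem laxHom_apply (s : Matrix F F K →ₐ[K] A) (M : Matrix (F × F) (F × F) K) (a c : F) :
    laxHom s M a c = s (Matrix.of fun b d => M (a, b) (c, d)) := rfl

/-- The action of a two-site operator on the sites `s` and `s'`. -/
def pairOp (s s' : Matrix F F K →ₐ[K] A) (M : Matrix (F × F) (F × F) K) : A :=
  contract s (laxHom s' M)

theorem Commute.pairOp_right {s s' : Matrix F F K →ₐ[K] A} {y : A}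
    (h : ∀ x, Commute y (s x)) (h' : ∀ x, Commute y (s' x)) (M : Matrix (F × F) (F × F) K) :
    Commute y (pairOp s s' M) := by
  rw [pairOp, contract]
  refine Commute.sum_right _ _ _ fun a _ => Commute.sum_right _ _ _ fun b _ => ?_
  exact (h' _).mul_right (h _)

theorem pairOp_mul {s s' : Matrix F F K →ₐ[K] A} (h : ∀ x y, Commute (s x) (s' y))
    (M M' : Matrix (F × F) (F × F) K) :
    pairOp s s' (M * M') = pairOp s s' M * pairOp s s' M' := by
  rw [pairOp, map_mul, contract_mul]
  · rfl
  · exact fun _ _ _ => (h _ _).symm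

theorem pairOp_swap {s s' : Matrix F F K →ₐ[K] A} (h : ∀ x y, Commute (s x) (s' y))
    (M : Matrix (F × F) (F × F) K) :
    pairOp s' s (M.submatrix Prod.swap Prod.swap) = pairOp s s' M := by
  simp only [pairOp, contract, laxHom_apply]
  simp only [map_eq_sum_smul s (Matrix.of _), map_eq_sum_smul s' (Matrix.of _), Matrix.of_apply,
    submatrix_apply, Prod.swap_prod_mk, Finset.sum_mul, smul_mul_assoc,
    fun a b c d => (h (single a b 1) (single c d 1)).eq]
  have hcomm (f : F → F → F → F → A) :
      ∑ a, ∑ b, ∑ c, ∑ d, f a b c d = ∑ c, ∑ d, ∑ a, ∑ b, f a b c d := by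
    simpa only [Fintype.sum_prod_type] using Finset.sum_comm (s := Finset.univ)
      (t := Finset.univ) (f := fun p q : F × F => f p.1 p.2 q.1 q.2)
  exact hcomm _

variable (s : ι → Matrix F F K →ₐ[K] A) (ρ : ι → ι → Matrix (F × F) (F × F) K)

/-- The monodromy matrix, as a matrix over the auxiliary space, at the inhomogeneity of
the site `k`, for the sites in the list `l`. -/
def monodromy (l : List ι) (k : ι) : Matrix F F A :=
  (l.map fun j => laxHom (s j) (ρ k j)).reverse.prod

variable {s ρ}

theorem monodromy_apply_mem {S : Subring A} {l : List ι} (h : ∀ j ∈ l, ∀ x, s j x ∈ S)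
    (k : ι) (a b : F) : monodromy s ρ l k a b ∈ S := by
  have hmem : monodromy s ρ l k ∈ S.matrix (n := F) := by
    refine Subring.list_prod_mem _ ?_
    simp only [List.mem_reverse, List.mem_map, forall_exists_index, and_imp,
      forall_apply_eq_imp_iff₂]
    exact fun j hj a b => h j hj _
  exact hmem a b

theorem Commute.monodromy_apply_right {y : A} {l : List ι} (h : ∀ j ∈ l, ∀ x, Commute y (s j x))
    (k : ι) (a b : F) : Commute y (monodromy s ρ l k a b) := by
  have hmem := monodromy_apply_mem (S := Subring.centralizer {y}) (ρ := ρ)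
    (fun j hj x => by
      rw [Subring.mem_centralizer_iff]
      rintro _ rfl
      exact (h j hj x).eq) k a b
  exact Subring.mem_centralizer_iff.1 hmem y rfl

theorem contract_monodromy (hs : ∀ i j, i ≠ j → ∀ x y, Commute (s i x) (s j y))
    {l : List ι} {k : ι} (hk : k ∉ l) :
    contract (s k) (monodromy s ρ l k) =
      (l.map fun j => pairOp (s k) (s j) (ρ k j)).reverse.prod := by
  induction l using List.reverseRecOn with
  | nil => simp [monodromy, contract_one]
  | append_singleton l j ih =>
    have hsplit : monodromy s ρ (l ++ [j]) k = laxHom (s j) (ρ k j) * monodromy s ρ l k := by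
      simp [monodromy]
    simp only [List.mem_append, List.mem_singleton, not_or] at hk
    rw [hsplit, contract_mul, ih hk.1]
    · simp [pairOp]
    · exact fun a b x => (Commute.monodromy_apply_right
        (fun i hi y => hs k i (by rintro rfl; exact hk.1 hi) x y) k a b).symm

/-- The trace over the auxiliary space of the monodromy matrix twisted by `x`, at the
inhomogeneity of the site `k`. -/
theorem trace_map_mul_monodromy (hs : ∀ i j, i ≠ j → ∀ x y, Commute (s i x) (s j y))
    {p q : List ι} {k : ι} (hl : (p ++ k :: q).Nodup)
    (hρ : ρ k k = Matrix.of fun a b => if a.1 = b.2 ∧ a.2 = b.1 then 1 else 0)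
    (x : Matrix F F K) :
    trace (x.map (algebraMap K A) * monodromy s ρ (p ++ k :: q) k) =
      (p.map fun j => pairOp (s k) (s j) (ρ k j)).reverse.prod * s k x *
        (q.map fun j => pairOp (s k) (s j) (ρ k j)).reverse.prod := by
  rw [List.nodup_append, List.nodup_cons] at hl
  obtain ⟨-, ⟨hkq, -⟩, hdisj⟩ := hl
  have hkp : k ∉ p := fun h => hdisj k h k List.mem_cons_self rfl
  have hperm : laxHom (s k) (ρ k k) = Matrix.of fun a c => s k (single c a 1) := by
    ext a c
    rw [laxHom_apply, hρ, Matrix.of_apply]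
    congr 1
    ext b d
    simp only [Matrix.of_apply, single_apply]
    congr 1
    exact propext ⟨fun h => ⟨h.2.symm, h.1⟩, fun h => ⟨h.2, h.1.symm⟩⟩
  have hsplit : monodromy s ρ (p ++ k :: q) k =
      monodromy s ρ q k * (Matrix.of fun a c => s k (single c a 1)) * monodromy s ρ p k := by
    simp [monodromy, hperm, mul_assoc]
  have hsk : ∀ l : List ι, k ∉ l → ∀ a b y, Commute (monodromy s ρ l k a b) (s k y) :=
    fun l hk a b y => (Commute.monodromy_apply_right
      (fun i hi z => hs k i (by rintro rfl; exact hk hi) y z) k a b).symm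
  rw [hsplit, ← mul_assoc, ← mul_assoc, trace_mul_permutation_mul, contract_mul, contract_mul,
    contract_map_algebraMap, contract_monodromy hs hkp, contract_monodromy hs hkq, mul_assoc]
  · exact hsk q hkq
  · intro a b y
    rw [Matrix.mul_apply]
    exact Commute.sum_left _ _ _ fun c _ =>
      (Algebra.commute_algebraMap_left _ _).mul_left (hsk q hkq _ _ _)
  · exact hsk p hkp
  · intro a b c d
    rw [Matrix.mul_apply]
    refine Commute.sum_right _ _ _ fun e _ =>
      (Algebra.commute_algebraMap_right _ _).mul_right ?_
    refine Commute.monodromy_apply_right (fun j hj y => ?_) _ _ _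
    refine (Commute.monodromy_apply_right (fun i hi z => ?_) _ _ _).symm
    exact hs j i (hdisj i hi j (List.mem_cons_of_mem _ hj)).symm _ _

/-- Reconstruction of a one-site operator from a unitary solution `ρ` that is regular at
coinciding inhomogeneities. -/
theorem prod_trace_mul_trace_map_mul (hs : ∀ i j, i ≠ j → ∀ x y, Commute (s i x) (s j y))
    (hperm : ∀ k, ρ k k = Matrix.of fun a b => if a.1 = b.2 ∧ a.2 = b.1 then 1 else 0)
    (hswap : ∀ i j, (ρ i j).submatrix Prod.swap Prod.swap = ρ i j)
    (hunit : ∀ i j, i ≠ j → ρ i j * ρ j i = 1)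
    {l p q : List ι} {k : ι} (hl : l.Nodup) (hpq : l = p ++ k :: q) (x : Matrix F F K) :
    (p.map fun i => trace (monodromy s ρ l i)).prod *
        trace (x.map (algebraMap K A) * monodromy s ρ l k) =
      s k x * ((p ++ [k]).map fun i => trace (monodromy s ρ l i)).prod := by
  have htrace : trace (x.map (algebraMap K A) * monodromy s ρ l k) = _ :=
    hpq ▸ trace_map_mul_monodromy hs (hpq ▸ hl) (hperm k) x
  rw [htrace]
  refine prod_map_mul_eq_mul_prod_map (fun i j => pairOp (s i) (s j) (ρ i j)) _ hl ?_ ?_ ?_ hpq ?_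
  · intro i j hij
    have hji : pairOp (s j) (s i) (ρ j i) = pairOp (s i) (s j) (ρ j i) := by
      rw [← pairOp_swap (hs i j hij), hswap]
    rw [hji, ← pairOp_mul (hs i j hij), hunit i j hij, pairOp, map_one, contract_one]
  · intro i j k m hik him hjk hjm
    have hr (m : ι) (him : i ≠ m) (hjm : j ≠ m) (y) :
        Commute (pairOp (s i) (s j) (ρ i j)) (s m y) :=
      (Commute.pairOp_right (fun _ => hs _ _ him.symm _ _) (fun _ => hs _ _ hjm.symm _ _) _).symm
    exact Commute.pairOp_right (hr k hik hjk) (hr m him hjm) _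
  · intro p k q hpq
    have h := trace_map_mul_monodromy hs (hpq ▸ hl) (hperm k) 1
    rwa [Matrix.map_one _ (map_zero _) (map_one _), one_mul, map_one, mul_one, ← hpq] at h
  · exact fun i j hi hj => Commute.pairOp_right (fun y => hs _ _ hi.symm _ _)
      (fun y => hs _ _ hj.symm _ _) _

end LocalOperators

section SpinChain

variable {N : ℕ}

/-- The tensor product of the one-site operators `x j`, as an operator on H. -/
def tensorOp : (Fin N → Matrix (Fin 2) (Fin 2) ℂ) →*
    Matrix (Fin N → Fin 2) (Fin N → Fin 2) ℂ where
  toFun x := Matrix.of fun u v => ∏ j, x j (u j) (v j)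
  map_one' := by
    ext u v
    simp only [Matrix.of_apply, Pi.one_apply, Matrix.one_apply, Finset.prod_ite_zero,
      Finset.prod_const_one, Finset.mem_univ, true_implies, funext_iff]
  map_mul' x y := by
    ext u v
    simp only [Matrix.of_apply, Pi.mul_apply, Matrix.mul_apply, ← Finset.prod_mul_distrib]
    exact (Fintype.prod_sum fun j c => x j (u j) c * y j c (v j))

theorem embH_eq_tensorOp_mulSingle (n : Fin N) (x : Matrix (Fin 2) (Fin 2) ℂ) :
    embH n x = tensorOp (Pi.mulSingle n x) := by
  ext u v
  simp only [embH, tensorOp, MonoidHom.coe_mk, OneHom.coe_mk, Matrix.of_apply]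
  rw [← Finset.mul_prod_erase _ _ (Finset.mem_univ n),
    ← Finset.mul_prod_erase _ (fun j =>
      (Pi.mulSingle n x : Fin N → Matrix (Fin 2) (Fin 2) ℂ) j (u j) (v j)) (Finset.mem_univ n),
    Pi.mulSingle_eq_same, if_pos rfl, one_mul]
  congr 1
  refine Finset.prod_congr rfl fun j hj => ?_
  rw [Pi.mulSingle_eq_of_ne (Finset.ne_of_mem_erase hj), if_neg (Finset.ne_of_mem_erase hj),
    Matrix.one_apply]

theorem commute_embH {i j : Fin N} (hij : i ≠ j) (x y : Matrix (Fin 2) (Fin 2) ℂ) :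
    Commute (embH i x) (embH j y) := by
  rw [embH_eq_tensorOp_mulSingle, embH_eq_tensorOp_mulSingle]
  exact Commute.map
    (Pi.mulSingle_commute (f := fun _ : Fin N => Matrix (Fin 2) (Fin 2) ℂ) hij x y) tensorOp

/-- The embedding `embH n` as an algebra homomorphism. -/
def siteHom (n : Fin N) :
    Matrix (Fin 2) (Fin 2) ℂ →ₐ[ℂ] Matrix (Fin N → Fin 2) (Fin N → Fin 2) ℂ :=
  AlgHom.ofLinearMap
    { toFun := embH n
      map_add' := fun x y => by ext u v; simp [embH, add_mul]
      map_smul' := fun c x => by ext u v; simp [embH, mul_assoc] }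
    (by simp [embH_eq_tensorOp_mulSingle])
    (fun x y => by simp [embH_eq_tensorOp_mulSingle, Pi.mulSingle_mul])

theorem Tmon_eq_compAlgEquiv_monodromy (η : ℂ) (ξ : Fin N → ℂ) (k : Fin N) :
    Tmon η ξ (ξ k) = compAlgEquiv (Fin 2) (Fin N → Fin 2) ℂ ℂ
      (monodromy siteHom (fun i j => Rxxz η (ξ i) (ξ j)) (List.finRange N) k) := by
  rw [Tmon, monodromy, map_list_prod, List.map_reverse, List.map_map, List.ofFn_eq_map]
  rfl

theorem blkT_eq_monodromy_apply (η : ℂ) (ξ : Fin N → ℂ) (k : Fin N) (a b : Fin 2) :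
    blkT η ξ a b (ξ k) =
      monodromy siteHom (fun i j => Rxxz η (ξ i) (ξ j)) (List.finRange N) k a b := by
  rw [blkT, Tmon_eq_compAlgEquiv_monodromy]
  rfl

theorem tT_eq_trace_monodromy (η : ℂ) (ξ : Fin N → ℂ) (k : Fin N) :
    tT η ξ (ξ k) =
      trace (monodromy siteHom (fun i j => Rxxz η (ξ i) (ξ j)) (List.finRange N) k) := by
  rw [tT, blkT_eq_monodromy_apply, blkT_eq_monodromy_apply, trace_fin_two]

theorem prodT_eq_prod_map_take (η : ℂ) (ξ : Fin N → ℂ) (n : ℕ) (h : n ≤ N) :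
    prodT η ξ n h = (((List.finRange N).take n).map fun i => tT η ξ (ξ i)).prod := by
  rw [prodT]
  congr 1
  apply List.ext_getElem
  · simp [h]
  · intro i h₁ h₂
    simp [Fin.castLE]

theorem Rmat_submatrix_swap (b c : ℂ) :
    (Rmat b c).submatrix Prod.swap Prod.swap = Rmat b c := by
  ext ⟨i, j⟩ ⟨k, l⟩
  fin_cases i <;> fin_cases j <;> fin_cases k <;> fin_cases l <;> simp [Rmat]

theorem Rxxz_self {η : ℂ} (hη : Complex.sinh η ≠ 0) (mu : ℂ) :
    Rxxz η mu mu = Matrix.of fun a b => if a.1 = b.2 ∧ a.2 = b.1 then 1 else 0 := by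
  ext ⟨i, j⟩ ⟨k, l⟩
  fin_cases i <;> fin_cases j <;> fin_cases k <;> fin_cases l <;> simp [Rxxz, Rmat, hη]

theorem Rmat_mul_Rmat {b c b' c' : ℂ} (h₁ : b * b' + c * c' = 1) (h₂ : b * c' + c * b' = 0) :
    Rmat b c * Rmat b' c' = 1 := by
  ext ⟨i, j⟩ ⟨k, l⟩
  rw [Matrix.mul_apply, Fintype.sum_prod_type]
  fin_cases i <;> fin_cases j <;> fin_cases k <;> fin_cases l <;>
    simp [Rmat, Fin.sum_univ_two] <;> first | linear_combination h₁ | linear_combination h₂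

theorem Rxxz_mul_Rxxz {η lam mu : ℂ} (h : Complex.sinh (lam - mu + η) ≠ 0)
    (h' : Complex.sinh (mu - lam + η) ≠ 0) : Rxxz η lam mu * Rxxz η mu lam = 1 := by
  rw [show mu - lam = -(lam - mu) by ring] at h'
  rw [Rxxz, Rxxz, show mu - lam = -(lam - mu) by ring]
  generalize lam - mu = u at h h'
  apply Rmat_mul_Rmat
  · rw [div_mul_div_comm, div_mul_div_comm, ← add_div, div_eq_one_iff_eq (mul_ne_zero h h'),
      Complex.sinh_add, Complex.sinh_add, Complex.sinh_neg, Complex.cosh_neg]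
    linear_combination Complex.sinh u ^ 2 * Complex.cosh_sq_sub_sinh_sq η -
      Complex.sinh η ^ 2 * Complex.cosh_sq_sub_sinh_sq u
  · rw [div_mul_div_comm, div_mul_div_comm, ← add_div, Complex.sinh_neg]
    ring

end SpinChain

/-- reconstruction of the local operator `S^z = (1/2)·diag(1,−1)`
for the XXZ chain:
`(∏_{i=1}^{n−1}(A+D)(ξ_i)) · (1/2)(A−D)(ξ_n) = S^z_n · (∏_{i=1}^{n}(A+D)(ξ_i))`;
equivalently, if the `(A+D)(ξ_i)` are invertible,
`S^z_n = (∏_{i=1}^{n−1}(A+D)(ξ_i)) · (1/2)(A−D)(ξ_n) · (∏_{i=1}^{n}(A+D)(ξ_i))⁻¹`. -/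
theorem xxz_reconstruction_Sz (η : ℂ) (hη : Complex.sinh η ≠ 0) {N : ℕ} (ξ : Fin N → ℂ)
    (hreg : ∀ i j : Fin N, Complex.sinh (ξ i - ξ j + η) ≠ 0) (n : Fin N) :
    prodT η ξ n.val n.isLt.le *
        ((1 / 2 : ℂ) • (blkT η ξ 0 0 (ξ n) - blkT η ξ 1 1 (ξ n))) =
        embH n !![1 / 2, 0; 0, -(1 / 2)] * prodT η ξ (n.val + 1) n.isLt ∧
      ((∀ i : Fin N, IsUnit (tT η ξ (ξ i))) →
        embH n !![1 / 2, 0; 0, -(1 / 2)] =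
          prodT η ξ n.val n.isLt.le *
            ((1 / 2 : ℂ) • (blkT η ξ 0 0 (ξ n) - blkT η ξ 1 1 (ξ n))) *
            (prodT η ξ (n.val + 1) n.isLt)⁻¹) := by
  have hpq : List.finRange N =
      (List.finRange N).take n.val ++ n :: (List.finRange N).drop (n.val + 1) := by
    conv_lhs => rw [← List.take_append_drop n.val (List.finRange N)]
    rw [List.drop_eq_getElem_cons (by simp)]
    simp
  have htake : (List.finRange N).take (n.val + 1) = (List.finRange N).take n.val ++ [n] := by
    rw [List.take_add_one]
    simp
  have hz : (1 / 2 : ℂ) • (blkT η ξ 0 0 (ξ n) - blkT η ξ 1 1 (ξ n)) =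
      trace ((!![1 / 2, 0; 0, -(1 / 2)] : Matrix (Fin 2) (Fin 2) ℂ).map (algebraMap ℂ _) *
        monodromy siteHom (fun i j => Rxxz η (ξ i) (ξ j)) (List.finRange N) n) := by
    rw [blkT_eq_monodromy_apply, blkT_eq_monodromy_apply, trace_fin_two, Matrix.mul_apply,
      Matrix.mul_apply, Fin.sum_univ_two, Fin.sum_univ_two]
    simp only [Matrix.map_apply, Matrix.of_apply, Matrix.cons_val', Matrix.cons_val_zero,
      Matrix.cons_val_one, Matrix.cons_val_fin_one, map_zero, zero_mul, add_zero, zero_add,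
      ← Algebra.smul_def, neg_smul]
    rw [smul_sub, sub_eq_add_neg]
  have hrec : prodT η ξ n.val n.isLt.le *
      ((1 / 2 : ℂ) • (blkT η ξ 0 0 (ξ n) - blkT η ξ 1 1 (ξ n))) =
      embH n !![1 / 2, 0; 0, -(1 / 2)] * prodT η ξ (n.val + 1) n.isLt := by
    rw [hz, prodT_eq_prod_map_take, prodT_eq_prod_map_take, htake]
    simp only [tT_eq_trace_monodromy]
    exact prod_trace_mul_trace_map_mul (s := siteHom) (ρ := fun i j => Rxxz η (ξ i) (ξ j))
      (fun i j hij => commute_embH hij) (fun k => Rxxz_self hη (ξ k))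
      (fun i j => Rmat_submatrix_swap _ _) (fun i j _ => Rxxz_mul_Rxxz (hreg i j) (hreg j i))
      (List.nodup_finRange N) hpq _
  refine ⟨hrec, fun hunit => ?_⟩
  have hprod : IsUnit (prodT η ξ (n.val + 1) n.isLt) := by
    rw [prodT, ← IsUnit.mem_submonoid_iff]
    refine Submonoid.list_prod_mem _ fun y hy => ?_
    obtain ⟨i, rfl⟩ := List.mem_ofFn.1 hy
    exact hunit _
  rw [hrec, mul_nonsing_inv_cancel_right _ _ ((isUnit_iff_isUnit_det _).1 hprod)]
end
end

section
/- The (unnormalized) trigonometric sl_{n+1} R-matrix Ř(λ) = e^{λ} R − e^{−λ} R̄ satisfies the Yang–Baxter equation Ř_{12}(λ−μ) Ř_{13}(λ−ν) Ř_{23}(μ−ν) = Ř_{23}(μ−ν) Ř_{13}(λ−ν) Ř_{12}(λ−μ) on ℂ^{n+1} ⊗ ℂ^{n+1} ⊗ ℂ^{n+1}, for all λ, μ, ν ∈ ℂ, where subscripts indicate the pair of tensor factors on which the operator acts. -/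
open Matrix Complex

noncomputable section

/-- The constant matrix
`R = Σ_{α≠β} E^{αα}⊗E^{ββ} + q Σ_α E^{αα}⊗E^{αα} + (q−q⁻¹) Σ_{α<β} E^{αβ}⊗E^{βα}`
on ℂ^{n+1} ⊗ ℂ^{n+1}. -/
def RqM (n : ℕ) (q : ℂ) :
    Matrix (Fin (n + 1) × Fin (n + 1)) (Fin (n + 1) × Fin (n + 1)) ℂ :=
  Matrix.of fun p r =>
    (if p.1 = r.1 ∧ p.2 = r.2 ∧ p.1 ≠ p.2 then 1 else 0) +
    (if p.1 = p.2 ∧ p.1 = r.1 ∧ p.2 = r.2 then q else 0) +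
    (if p.1 = r.2 ∧ p.2 = r.1 ∧ p.1 < p.2 then q - q⁻¹ else 0)

/-- The constant matrix
`R̄ = Σ_{α≠β} E^{αα}⊗E^{ββ} + q⁻¹ Σ_α E^{αα}⊗E^{αα} − (q−q⁻¹) Σ_{α>β} E^{αβ}⊗E^{βα}`
on ℂ^{n+1} ⊗ ℂ^{n+1}. -/
def RbarM (n : ℕ) (q : ℂ) :
    Matrix (Fin (n + 1) × Fin (n + 1)) (Fin (n + 1) × Fin (n + 1)) ℂ :=
  Matrix.of fun p r =>
    (if p.1 = r.1 ∧ p.2 = r.2 ∧ p.1 ≠ p.2 then 1 else 0) +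
    (if p.1 = p.2 ∧ p.1 = r.1 ∧ p.2 = r.2 then q⁻¹ else 0) -
    (if p.1 = r.2 ∧ p.2 = r.1 ∧ p.2 < p.1 then q - q⁻¹ else 0)

/-- The unnormalized trigonometric sl_{n+1} R-matrix `Ř(λ) = e^λ R − e^{−λ} R̄`. -/
def Rcheck (n : ℕ) (q : ℂ) (lam : ℂ) :
    Matrix (Fin (n + 1) × Fin (n + 1)) (Fin (n + 1) × Fin (n + 1)) ℂ :=
  Complex.exp lam • RqM n q - Complex.exp (-lam) • RbarM n q

/-- Embedding of a two-leg operator into legs 1,2 of a three-fold tensor product. -/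
def e12 {α β γ : Type*} [DecidableEq γ]
    (M : Matrix (α × β) (α × β) ℂ) : Matrix (α × β × γ) (α × β × γ) ℂ :=
  Matrix.of fun p q => M (p.1, p.2.1) (q.1, q.2.1) * (if p.2.2 = q.2.2 then 1 else 0)

/-- Embedding of a two-leg operator into legs 1,3 of a three-fold tensor product. -/
def e13 {α β γ : Type*} [DecidableEq β]
    (M : Matrix (α × γ) (α × γ) ℂ) : Matrix (α × β × γ) (α × β × γ) ℂ :=
  Matrix.of fun p q => M (p.1, p.2.2) (q.1, q.2.2) * (if p.2.1 = q.2.1 then 1 else 0)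

/-- Embedding of a two-leg operator into legs 2,3 of a three-fold tensor product. -/
def e23 {α β γ : Type*} [DecidableEq α]
    (M : Matrix (β × γ) (β × γ) ℂ) : Matrix (α × β × γ) (α × β × γ) ℂ :=
  Matrix.of fun p q => M (p.2.1, p.2.2) (q.2.1, q.2.2) * (if p.1 = q.1 then 1 else 0)

/-- The coefficient of `E^{ii} ⊗ E^{jj}` in the `R`-matrix with multiplicative parameter `x`. -/
def diagWeight {n : ℕ} (q x : ℂ) (i j : Fin (n + 1)) : ℂ :=
  if i = j then q * x - q⁻¹ * x⁻¹ else x - x⁻¹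

/-- The coefficient of `E^{ij} ⊗ E^{ji}`, for `i ≠ j`, in the `R`-matrix with multiplicative
parameter `x`. -/
def exchangeWeight {n : ℕ} (q x : ℂ) (i j : Fin (n + 1)) : ℂ :=
  if i < j then (q - q⁻¹) * x else if j < i then (q - q⁻¹) * x⁻¹ else 0

theorem Rcheck_apply (n : ℕ) (q lam : ℂ) (i j k l : Fin (n + 1)) :
    Rcheck n q lam (i, j) (k, l) =
      diagWeight q (exp lam) i j * (if i = k ∧ j = l then 1 else 0) +
        exchangeWeight q (exp lam) i j * (if i = l ∧ j = k then 1 else 0) := by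
  simp only [Rcheck, RqM, RbarM, Matrix.sub_apply, Matrix.smul_apply, Matrix.of_apply,
    smul_eq_mul, Complex.exp_neg, diagWeight, exchangeWeight]
  rcases lt_trichotomy i j with h | rfl | h
  · simp [h, h.ne, h.not_gt]
    split_ifs <;> ring
  · simp
    split_ifs <;> ring
  · simp [h, h.ne', h.not_gt]
    split_ifs <;> ring

theorem sum_Rcheck_mul (n : ℕ) (q lam : ℂ) (i j : Fin (n + 1))
    (G : Fin (n + 1) → Fin (n + 1) → ℂ) :
    ∑ k, ∑ l, Rcheck n q lam (i, j) (k, l) * G k l =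
      diagWeight q (exp lam) i j * G i j + exchangeWeight q (exp lam) i j * G j i := by
  simp [Rcheck_apply, add_mul, Finset.sum_add_distrib, ite_and]

theorem e12_Rcheck_mulVec (n : ℕ) (q lam : ℂ)
    (F : Fin (n + 1) × Fin (n + 1) × Fin (n + 1) → ℂ) (i j k : Fin (n + 1)) :
    (e12 (γ := Fin (n + 1)) (Rcheck n q lam) *ᵥ F) (i, j, k) =
      diagWeight q (exp lam) i j * F (i, j, k) +
        exchangeWeight q (exp lam) i j * F (j, i, k) := by
  rw [← sum_Rcheck_mul n q lam i j fun a b => F (a, b, k)]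
  simp [Matrix.mulVec, dotProduct, e12, Fintype.sum_prod_type]

theorem e13_Rcheck_mulVec (n : ℕ) (q lam : ℂ)
    (F : Fin (n + 1) × Fin (n + 1) × Fin (n + 1) → ℂ) (i j k : Fin (n + 1)) :
    (e13 (β := Fin (n + 1)) (Rcheck n q lam) *ᵥ F) (i, j, k) =
      diagWeight q (exp lam) i k * F (i, j, k) +
        exchangeWeight q (exp lam) i k * F (k, j, i) := by
  rw [← sum_Rcheck_mul n q lam i k fun a b => F (a, j, b)]
  simp only [Matrix.mulVec, dotProduct, e13, Fintype.sum_prod_type, Matrix.of_apply]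
  refine Finset.sum_congr rfl fun a _ => ?_
  rw [Finset.sum_comm]
  simp

theorem e23_Rcheck_mulVec (n : ℕ) (q lam : ℂ)
    (F : Fin (n + 1) × Fin (n + 1) × Fin (n + 1) → ℂ) (i j k : Fin (n + 1)) :
    (e23 (α := Fin (n + 1)) (Rcheck n q lam) *ᵥ F) (i, j, k) =
      diagWeight q (exp lam) j k * F (i, j, k) +
        exchangeWeight q (exp lam) j k * F (i, k, j) := by
  rw [← sum_Rcheck_mul n q lam j k fun a b => F (i, a, b)]
  simp only [Matrix.mulVec, dotProduct, e23, Fintype.sum_prod_type, Matrix.of_apply]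
  rw [Finset.sum_eq_single i]
  · simp
  · intro a _ h
    simp [h.symm]
  · simp

/-- the unnormalized trigonometric sl_{n+1} R-matrix `Ř(λ) = e^λ R − e^{−λ} R̄`
satisfies the Yang–Baxter equation
`Ř₁₂(λ−μ) Ř₁₃(λ−ν) Ř₂₃(μ−ν) = Ř₂₃(μ−ν) Ř₁₃(λ−ν) Ř₁₂(λ−μ)` on (ℂ^{n+1})^{⊗3}. -/
theorem sln_yang_baxter (n : ℕ) (hn : 1 ≤ n) (q : ℂ) (hq : q ≠ 0) (lam mu nu : ℂ) :
    e12 (γ := Fin (n + 1)) (Rcheck n q (lam - mu)) *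
        e13 (β := Fin (n + 1)) (Rcheck n q (lam - nu)) *
        e23 (α := Fin (n + 1)) (Rcheck n q (mu - nu)) =
      e23 (α := Fin (n + 1)) (Rcheck n q (mu - nu)) *
        e13 (β := Fin (n + 1)) (Rcheck n q (lam - nu)) *
        e12 (γ := Fin (n + 1)) (Rcheck n q (lam - mu)) := by
  refine Matrix.ext_of_mulVec_single fun r => ?_
  simp only [← Matrix.mulVec_mulVec]
  funext ⟨i, j, k⟩
  simp only [e12_Rcheck_mulVec, e13_Rcheck_mulVec, e23_Rcheck_mulVec]
  generalize (Pi.single r 1 : Fin (n + 1) × Fin (n + 1) × Fin (n + 1) → ℂ) = F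
  have hxz : exp (lam - nu) = exp (lam - mu) * exp (mu - nu) := by
    rw [← Complex.exp_add]; ring_nf
  have hx : exp (lam - mu) ≠ 0 := Complex.exp_ne_zero _
  have hy : exp (mu - nu) ≠ 0 := Complex.exp_ne_zero _
  unfold diagWeight exchangeWeight
  rw [hxz]
  generalize exp (lam - mu) = x at *
  generalize exp (mu - nu) = y at *
  rcases lt_trichotomy i j with hij | hij | hij <;>
  rcases lt_trichotomy j k with hjk | hjk | hjk <;>
  rcases lt_trichotomy i k with hik | hik | hik <;>
  first
  | (exfalso; omega)
  | (subst_vars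
     simp only [*, lt_irrefl, if_true, if_false, ne_of_lt, ne_of_gt, not_lt_of_gt]
     try field_simp
     try ring)
end
end

section
/- For all λ, μ ∈ ℂ, the spin-l/2 Lax operator satisfies the RTT relation with the rational XXX R-matrix: R_{12}(λ−μ) L_1(λ) L_2(μ) = L_2(μ) L_1(λ) R_{12}(λ−μ) as operators on ℂ²_1 ⊗ ℂ²_2 ⊗ ℂ^{l+1}, where R_{12}(u) = u·Id + η·P acts on the two auxiliary copies of ℂ² (P the permutation operator), L_1(λ) acts on the first auxiliary copy and ℂ^{l+1}, and L_2(μ) acts on the second auxiliary copy and ℂ^{l+1}. -/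
open Matrix Complex

noncomputable section

/-- The spin-l/2 operator `S^z` on ℂ^{l+1}: `S^z e_k = (l/2 − k) e_k`. -/
def Szm (l : ℕ) : Matrix (Fin (l + 1)) (Fin (l + 1)) ℂ :=
  Matrix.of fun i j => if i = j then ((l : ℂ) / 2 - (i : ℕ)) else 0

/-- The spin-l/2 operator `S^−` on ℂ^{l+1}: `S^− e_k = e_{k+1}` (`S^− e_l = 0`). -/
def Smm (l : ℕ) : Matrix (Fin (l + 1)) (Fin (l + 1)) ℂ :=
  Matrix.of fun i j => if (i : ℕ) = (j : ℕ) + 1 then 1 else 0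

/-- The spin-l/2 operator `S^+` on ℂ^{l+1}: `S^+ e_k = k(l+1−k) e_{k−1}` (`S^+ e_0 = 0`). -/
def Spm (l : ℕ) : Matrix (Fin (l + 1)) (Fin (l + 1)) ℂ :=
  Matrix.of fun i j =>
    if (i : ℕ) + 1 = (j : ℕ) then ((j : ℕ) : ℂ) * ((l : ℂ) + 1 - (j : ℕ)) else 0

/-- The (unnormalized) spin-l/2 Lax operator on ℂ² ⊗ ℂ^{l+1}, in 2×2 block form
`L(λ) = [[λ + η(l/2 + S^z), η S^−],[η S^+, λ + η(l/2 − S^z)]]`. -/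
def Lax (η : ℂ) (l : ℕ) (lam : ℂ) :
    Matrix (Fin 2 × Fin (l + 1)) (Fin 2 × Fin (l + 1)) ℂ :=
  Matrix.of fun p q =>
    if p.1 = 0 ∧ q.1 = 0 then
      (if p.2 = q.2 then lam + η * ((l : ℂ) / 2) else 0) + η * Szm l p.2 q.2
    else if p.1 = 0 ∧ q.1 = 1 then η * Smm l p.2 q.2
    else if p.1 = 1 ∧ q.1 = 0 then η * Spm l p.2 q.2
    else (if p.2 = q.2 then lam + η * ((l : ℂ) / 2) else 0) - η * Szm l p.2 q.2

/-- The permutation operator on ℂ² ⊗ ℂ². -/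
def Pmat : Matrix (Fin 2 × Fin 2) (Fin 2 × Fin 2) ℂ :=
  Matrix.of fun p q => if p.1 = q.2 ∧ p.2 = q.1 then 1 else 0

/-- The rational R-matrix `R(u) = u·Id + η·P` on ℂ² ⊗ ℂ². -/
def Rrat (η u : ℂ) : Matrix (Fin 2 × Fin 2) (Fin 2 × Fin 2) ℂ :=
  u • (1 : Matrix (Fin 2 × Fin 2) (Fin 2 × Fin 2) ℂ) + η • Pmat

/-- The `(a, b)` block of the spin part of the Lax operator. -/
def spinBlock (l : ℕ) (a b : Fin 2) : Matrix (Fin (l + 1)) (Fin (l + 1)) ℂ :=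
  !![Szm l, Smm l; Spm l, -Szm l] a b

theorem Szm_eq_diagonal (l : ℕ) :
    Szm l = Matrix.diagonal fun i : Fin (l + 1) => (l : ℂ) / 2 - (i : ℕ) := by
  ext i j
  simp [Szm, Matrix.diagonal_apply]

theorem Szm_mul_Smm_sub (l : ℕ) : Szm l * Smm l - Smm l * Szm l = -Smm l := by
  ext i j
  rw [Szm_eq_diagonal, Matrix.sub_apply, Matrix.diagonal_mul, Matrix.mul_diagonal, Matrix.neg_apply]
  by_cases h : (i : ℕ) = j + 1
  · simp [Smm, h]
  · simp [Smm, h]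

theorem Szm_mul_Spm_sub (l : ℕ) : Szm l * Spm l - Spm l * Szm l = Spm l := by
  ext i j
  rw [Szm_eq_diagonal, Matrix.sub_apply, Matrix.diagonal_mul, Matrix.mul_diagonal]
  by_cases h : (i : ℕ) + 1 = j
  · simp only [Spm, Matrix.of_apply, ← h]
    push_cast
    ring
  · simp [Spm, h]

theorem Spm_mul_Smm (l : ℕ) : Spm l * Smm l =
    Matrix.diagonal fun i : Fin (l + 1) => ((i : ℕ) + 1 : ℂ) * ((l : ℂ) - (i : ℕ)) := by
  ext i j
  rw [Matrix.mul_apply, Matrix.diagonal_apply]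
  rcases Nat.lt_or_ge i l with hi | hi
  · rw [Finset.sum_eq_single (⟨i + 1, by omega⟩ : Fin (l + 1))]
    · simp [Spm, Smm, Fin.ext_iff]
    · intro k _ hk
      have : (i : ℕ) + 1 ≠ k := fun h => hk (Fin.ext h.symm)
      simp [Spm, this]
    · simp
  · have hil : (i : ℕ) = l := by omega
    rw [Finset.sum_eq_zero]
    · simp [hil]
    · intro k _
      have : (i : ℕ) + 1 ≠ k := by omega
      simp [Spm, this]

theorem Smm_mul_Spm (l : ℕ) : Smm l * Spm l =
    Matrix.diagonal fun i : Fin (l + 1) => ((i : ℕ) : ℂ) * ((l : ℂ) + 1 - (i : ℕ)) := by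
  ext i j
  rw [Matrix.mul_apply, Matrix.diagonal_apply]
  rcases Nat.eq_zero_or_pos (i : ℕ) with hi | hi
  · rw [Finset.sum_eq_zero]
    · simp [hi]
    · intro k _
      simp [Smm, hi]
  · rw [Finset.sum_eq_single (⟨i - 1, by omega⟩ : Fin (l + 1))]
    · have h : (i : ℕ) - 1 + 1 = i := by omega
      by_cases hij : i = j
      · subst hij
        simp [Spm, Smm, h]
      · have hij' : (i : ℕ) ≠ j := fun h => hij (Fin.ext h)
        simp [Spm, h, hij, hij']
    · intro k _ hk
      have : (i : ℕ) ≠ k + 1 := fun h => hk (Fin.ext (by simp [h]))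
      simp [Smm, this]
    · simp

theorem Spm_mul_Smm_sub (l : ℕ) : Spm l * Smm l - Smm l * Spm l = Szm l + Szm l := by
  rw [Spm_mul_Smm, Smm_mul_Spm]
  ext i j
  rw [Matrix.sub_apply, Matrix.add_apply, Matrix.diagonal_apply, Matrix.diagonal_apply]
  by_cases h : i = j
  · simp only [Szm, Matrix.of_apply, if_pos h]
    ring
  · simp [Szm, h]

theorem spinBlock_commutator (l : ℕ) (a b c d : Fin 2) :
    spinBlock l a c * spinBlock l b d - spinBlock l b d * spinBlock l a c =
      (if a = d then (1 : ℂ) else 0) • spinBlock l b c -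
        (if b = c then (1 : ℂ) else 0) • spinBlock l a d := by
  have hm := Szm_mul_Smm_sub l
  have hp := Szm_mul_Spm_sub l
  have hz := Spm_mul_Smm_sub l
  rw [sub_eq_iff_eq_add] at hm hp hz
  fin_cases a <;> fin_cases b <;> fin_cases c <;> fin_cases d <;>
    simp [spinBlock, hm, hp, hz] <;> abel

/-- The `(a, b)` block of the Lax operator. -/
def laxBlock (η : ℂ) (l : ℕ) (lam : ℂ) (a b : Fin 2) :
    Matrix (Fin (l + 1)) (Fin (l + 1)) ℂ :=
  ((lam + η * ((l : ℂ) / 2)) * if a = b then 1 else 0) • 1 + η • spinBlock l a b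

theorem Lax_apply (η : ℂ) (l : ℕ) (lam : ℂ) (a b : Fin 2) (i j : Fin (l + 1)) :
    Lax η l lam (a, i) (b, j) = laxBlock η l lam a b i j := by
  fin_cases a <;> fin_cases b <;>
    simp [Lax, laxBlock, spinBlock, Matrix.one_apply, sub_eq_add_neg]

theorem laxBlock_exchange (η : ℂ) (l : ℕ) (lam mu : ℂ) (a b c d : Fin 2) :
    (lam - mu) • (laxBlock η l lam a c * laxBlock η l mu b d) +
        η • (laxBlock η l lam b c * laxBlock η l mu a d) =
      (lam - mu) • (laxBlock η l mu b d * laxBlock η l lam a c) +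
        η • (laxBlock η l mu b c * laxBlock η l lam a d) := by
  have h := spinBlock_commutator l a b c d
  rw [sub_eq_iff_eq_add] at h
  simp only [laxBlock, add_mul, mul_add, smul_mul_assoc, mul_smul_comm, one_mul, mul_one, h]
  module

theorem e13_mul_e23_apply {α β γ : Type*} [Fintype α] [Fintype β] [Fintype γ]
    [DecidableEq α] [DecidableEq β] (M : Matrix (α × γ) (α × γ) ℂ)
    (N : Matrix (β × γ) (β × γ) ℂ) (a c : α) (b d : β) (i j : γ) :
    (e13 (β := β) M * e23 (α := α) N) (a, b, i) (c, d, j) =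
      ∑ k, M (a, i) (c, k) * N (b, k) (d, j) := by
  simp [Matrix.mul_apply, Fintype.sum_prod_type, e13, e23]

theorem e23_mul_e13_apply {α β γ : Type*} [Fintype α] [Fintype β] [Fintype γ]
    [DecidableEq α] [DecidableEq β] (M : Matrix (α × γ) (α × γ) ℂ)
    (N : Matrix (β × γ) (β × γ) ℂ) (a c : α) (b d : β) (i j : γ) :
    (e23 (α := α) N * e13 (β := β) M) (a, b, i) (c, d, j) =
      ∑ k, N (b, i) (d, k) * M (a, k) (c, j) := by
  simp [Matrix.mul_apply, Fintype.sum_prod_type, e13, e23]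

theorem e12_Rrat_mul_apply {γ : Type*} [Fintype γ] [DecidableEq γ] (η u : ℂ)
    (M : Matrix (Fin 2 × Fin 2 × γ) (Fin 2 × Fin 2 × γ) ℂ) (a b : Fin 2) (i : γ)
    (q : Fin 2 × Fin 2 × γ) :
    (e12 (γ := γ) (Rrat η u) * M) (a, b, i) q = u * M (a, b, i) q + η * M (b, a, i) q := by
  fin_cases a <;> fin_cases b <;>
    simp [Matrix.mul_apply, Fintype.sum_prod_type, e12, Rrat, Pmat, Matrix.one_apply, add_mul,
      add_comm]

theorem mul_e12_Rrat_apply {γ : Type*} [Fintype γ] [DecidableEq γ] (η u : ℂ)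
    (M : Matrix (Fin 2 × Fin 2 × γ) (Fin 2 × Fin 2 × γ) ℂ) (p : Fin 2 × Fin 2 × γ)
    (c d : Fin 2) (j : γ) :
    (M * e12 (γ := γ) (Rrat η u)) p (c, d, j) = u * M p (c, d, j) + η * M p (d, c, j) := by
  fin_cases c <;> fin_cases d <;>
    simp [Matrix.mul_apply, Fintype.sum_prod_type, e12, Rrat, Pmat, Matrix.one_apply, mul_add,
      mul_comm, add_comm, Finset.sum_add_distrib]

/-- the spin-l/2 Lax operator satisfies the RTT relation with the rational
XXX R-matrix: `R₁₂(λ−μ) L₁(λ) L₂(μ) = L₂(μ) L₁(λ) R₁₂(λ−μ)` on ℂ²₁ ⊗ ℂ²₂ ⊗ ℂ^{l+1}. -/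
theorem spin_lax_RTT (η : ℂ) (l : ℕ) (hl : 1 ≤ l) (lam mu : ℂ) :
    e12 (γ := Fin (l + 1)) (Rrat η (lam - mu)) * e13 (β := Fin 2) (Lax η l lam) *
        e23 (α := Fin 2) (Lax η l mu) =
      e23 (α := Fin 2) (Lax η l mu) * e13 (β := Fin 2) (Lax η l lam) *
        e12 (γ := Fin (l + 1)) (Rrat η (lam - mu)) := by
  ext ⟨a, b, i⟩ ⟨c, d, j⟩
  rw [Matrix.mul_assoc, e12_Rrat_mul_apply, mul_e12_Rrat_apply]
  simp only [e13_mul_e23_apply, e23_mul_e13_apply, Lax_apply, ← Matrix.mul_apply]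
  exact congrFun (congrFun (laxBlock_exchange η l lam mu a b c d) i) j
end
end
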